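/- arXiv:2106.00560 — 6 statements merged into one kernel-verified Lean document; each statement's English description precedes it below -/
import Mathlib

section
/- Let n ≥ 2, t ∈ ℕ, and let x ∈ ℕ^{t+1} be a frequency vector with Σ_{j=0}^{t} x_j = n. Define p̂ = x/n, regarded as a finitely supported element of ℓ² = ℓ²(ℕ; ℝ); let ĝ be the ℓ²-projection of p̂ onto F^decr and let r̂ be the decreasing rearrangement of p̂ (the (j+1)-th largest coordinate of p̂ in position j, zero beyond position t). For each j with x_j > 0 set p̂^{(−j)} = (x − δ^{[j]})/(n−1), where δ^{[j]} has a 1 in coordinate j and 0 elsewhere, and let r̂^{(−j)} and ĝ^{(−j)} be the decreasing rearrangement of p̂^{(−j)} and its ℓ²-projection onto F^decr; define π̂_j = p̂^{(−j)}_j, ρ̂_j = r̂^{(−j)}_j, γ̂_j = ĝ^{(−j)}_j when x_j > 0 and π̂_j = ρ̂_j = γ̂_j = 0 otherwise. Then for all j ∈ ℕ: π̂_j ≤ p̂_j, ρ̂_j ≤ (n/(n−1)) r̂_j, and γ̂_j ≤ (n/(n−1)) ĝ_j. -/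
/-- The decreasing cone in `ℓ² = ℓ²(ℕ; ℝ)`, viewed as a set of square-summable
non-increasing real sequences. -/
def FdecrSeq : Set (ℕ → ℝ) :=
  {f | Summable (fun j => f j ^ 2) ∧ ∀ j, f (j + 1) ≤ f j}

/-- `g` is the `ℓ²`-projection of `v` onto the decreasing cone. -/
def IsProjDecr (v g : ℕ → ℝ) : Prop :=
  g ∈ FdecrSeq ∧ ∀ f ∈ FdecrSeq, ∑' j, (v j - g j) ^ 2 ≤ ∑' j, (v j - f j) ^ 2

/-- `r` is the decreasing rearrangement of the sequence `v` supported on `{0, …, t}`. -/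
def IsRearSeqUpTo (t : ℕ) (v r : ℕ → ℝ) : Prop :=
  (∀ j k : ℕ, j ≤ k → k ≤ t → r k ≤ r j) ∧ (∀ j, t < j → r j = 0) ∧
  ∃ σ : Equiv.Perm (Fin (t + 1)), ∀ j : Fin (t + 1), r (j : ℕ) = v ((σ j : Fin (t + 1)) : ℕ)


lemma aux_sq_sub {a b : ℕ → ℝ} (ha : Summable (fun j => a j ^ 2))
    (hb : Summable (fun j => b j ^ 2)) : Summable (fun j => (a j - b j) ^ 2) := by
  refine Summable.of_nonneg_of_le (fun j => sq_nonneg _) (fun j => ?_)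
    ((ha.mul_left 2).add (hb.mul_left 2))
  nlinarith [sq_nonneg (a j + b j)]

lemma aux_nonneg {g : ℕ → ℝ} (hg : g ∈ FdecrSeq) (j : ℕ) : 0 ≤ g j := by
  obtain ⟨h1, h2⟩ := hg
  have hanti : Antitone g := antitone_nat_of_succ_le h2
  by_contra hneg
  push Not at hneg
  have ht := h1.tendsto_atTop_zero
  have hle : g j ^ 2 ≤ 0 := by
    refine ge_of_tendsto ht ?_
    filter_upwards [Filter.eventually_ge_atTop j] with k hk
    have := hanti hk
    nlinarith
  nlinarith

lemma aux_mono {v w g h : ℕ → ℝ} (hv : Summable (fun j => v j ^ 2))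
    (hw : Summable (fun j => w j ^ 2)) (hvw : ∀ j, v j ≤ w j)
    (hg : IsProjDecr v g) (hh : IsProjDecr w h) (j : ℕ) : g j ≤ h j := by
  obtain ⟨⟨gs, gd⟩, gm⟩ := hg
  obtain ⟨⟨hs, hd⟩, hm⟩ := hh
  have sgh := aux_sq_sub gs hs
  have hdd : ∀ k, max (g k - h k) 0 ^ 2 ≤ (g k - h k) ^ 2 := by
    intro k
    rcases le_total (g k - h k) 0 with H | H
    · rw [max_eq_right H]; nlinarith [sq_nonneg (g k - h k)]
    · rw [max_eq_left H]
  have sd : Summable (fun k => max (g k - h k) 0 ^ 2) :=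
    Summable.of_nonneg_of_le (fun k => sq_nonneg _) hdd sgh
  have sd2 : Summable (fun k => (max (g k - h k) 0 / 2) ^ 2) := by
    refine (sd.div_const 4).congr (fun k => ?_)
    ring
  have sd3 : Summable (fun k => (-(max (g k - h k) 0 / 2)) ^ 2) := by
    simpa using sd2
  have sf1 : Summable (fun k => (g k - max (g k - h k) 0 / 2) ^ 2) := aux_sq_sub gs sd2
  have sf2 : Summable (fun k => (h k - -(max (g k - h k) 0 / 2)) ^ 2) := aux_sq_sub hs sd3
  have m1 := gm (fun k => g k - max (g k - h k) 0 / 2) ⟨sf1, fun k => by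
    have := gd k
    have := hd k
    rcases le_total (g k - h k) 0 with H | H <;>
    rcases le_total (g (k+1) - h (k+1)) 0 with H' | H' <;>
    simp only [max_eq_left, max_eq_right, H, H'] <;> linarith⟩
  have m2 := hm (fun k => h k - -(max (g k - h k) 0 / 2)) ⟨sf2, fun k => by
    have := gd k
    have := hd k
    rcases le_total (g k - h k) 0 with H | H <;>
    rcases le_total (g (k+1) - h (k+1)) 0 with H' | H' <;>
    simp only [max_eq_left, max_eq_right, H, H'] <;> linarith⟩
  have s1 := aux_sq_sub hv gs
  have s2 := aux_sq_sub hw hs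
  have s3 := aux_sq_sub hv sf1
  have s4 := aux_sq_sub hw sf2
  have sd4 := sd.div_const 2
  have key := Summable.tsum_le_tsum (f := fun k => ((v k - (g k - max (g k - h k) 0 / 2)) ^ 2
      + (w k - (h k - -(max (g k - h k) 0 / 2))) ^ 2) + max (g k - h k) 0 ^ 2 / 2)
      (g := fun k => (v k - g k) ^ 2 + (w k - h k) ^ 2) (fun k => by
        have := hvw k
        rcases le_total (g k - h k) 0 with H | H
        · simp only [max_eq_right H]; apply le_of_eq; ring
        · simp only [max_eq_left H]
          nlinarith [mul_nonneg H (sub_nonneg.2 this)]) ((s3.add s4).add sd4) (s1.add s2)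
  rw [(s3.add s4).tsum_add sd4, s3.tsum_add s4, s1.tsum_add s2] at key
  have hj := sd4.le_tsum j (fun k _ => by positivity)
  have h0 : max (g j - h j) 0 ^ 2 ≤ 0 := by linarith
  have h1 : max (g j - h j) 0 = 0 := by
    have := sq_nonneg (max (g j - h j) 0)
    exact pow_eq_zero_iff (two_ne_zero) |>.1 (le_antisymm h0 this)
  have := le_max_left (g j - h j) 0
  linarith

lemma aux_scale {v g : ℕ → ℝ} {c : ℝ} (hc : 0 < c) (hg : IsProjDecr v g) :
    IsProjDecr (fun j => c * v j) (fun j => c * g j) := by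
  obtain ⟨⟨gs, gd⟩, gm⟩ := hg
  refine ⟨⟨?_, fun j => mul_le_mul_of_nonneg_left (gd j) hc.le⟩, ?_⟩
  · simpa only [mul_pow] using gs.mul_left (c ^ 2)
  · rintro f ⟨fs, fd⟩
    have := gm (fun j => f j / c) ⟨by simpa only [div_pow] using fs.div_const (c ^ 2),
      fun j => div_le_div_of_nonneg_right (fd j) hc.le⟩
    have e1 : ∀ j, (c * v j - c * g j) ^ 2 = c ^ 2 * (v j - g j) ^ 2 := fun j => by ring
    have e2 : ∀ j, (c * v j - f j) ^ 2 = c ^ 2 * (v j - f j / c) ^ 2 := fun j => by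
      field_simp
    simp only [e1, e2, tsum_mul_left]
    exact mul_le_mul_of_nonneg_left this (by positivity)

lemma aux_rear {t : ℕ} {v w r s : ℕ → ℝ} (hvw : ∀ j, v j ≤ w j)
    (hr : IsRearSeqUpTo t v r) (hs : IsRearSeqUpTo t w s) (j : ℕ) : r j ≤ s j := by
  obtain ⟨r1, r2, σ, hσ⟩ := hr
  obtain ⟨s1, s2, τ, hτ⟩ := hs
  rcases lt_or_ge t j with hj | hj
  · rw [r2 j hj, s2 j hj]
  by_contra hlt
  push Not at hlt
  let J : Fin (t + 1) := ⟨j, by omega⟩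
  have hmaps : ∀ i ∈ Finset.Iic J, τ.symm (σ i) ∈ Finset.Iio J := by
    intro i hi
    rw [Finset.mem_Iic] at hi
    rw [Finset.mem_Iio]
    by_contra hge
    push Not at hge
    have a1 := r1 i j hi hj
    have a2 := hσ i
    have a3 := hτ (τ.symm (σ i))
    rw [Equiv.apply_symm_apply] at a3
    have a4 := s1 j (τ.symm (σ i)) hge (by have := (τ.symm (σ i)).2; omega)
    have a5 := hvw (σ i)
    linarith
  have hcard := Finset.card_le_card_of_injOn (fun i => τ.symm (σ i)) hmaps
    (fun a _ b _ hab => by simpa using hab)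
  simp at hcard

/-- Lemma on leave-one-out estimators: for a frequency vector `x` with
total count `n ≥ 2` supported on `{0, …, t}`, with `p̂ = x/n`, Grenander estimator
`ĝ` (the ℓ²-projection of `p̂` onto `F^decr`), rearrangement estimator `r̂`, and the
leave-one-out versions `p̂^{(−j)} = (x − δ^{[j]})/(n−1)`, `ĝ^{(−j)}`, `r̂^{(−j)}`
(for `x_j > 0`), the diagonal leave-one-out values `π̂_j, ρ̂_j, γ̂_j` (set to `0`
when `x_j = 0`) satisfy `π̂_j ≤ p̂_j`, `ρ̂_j ≤ (n/(n−1)) r̂_j`, and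
`γ̂_j ≤ (n/(n−1)) ĝ_j` for all `j`. -/
theorem stmt2 (n t : ℕ) (hn : 2 ≤ n) (x : ℕ → ℕ)
    (hsupp : ∀ j, t < j → x j = 0)
    (hsum : ∑ j ∈ Finset.range (t + 1), x j = n)
    (phat : ℕ → ℝ) (hphat : ∀ j, phat j = (x j : ℝ) / n)
    (ghat rhat : ℕ → ℝ)
    (hg : IsProjDecr phat ghat) (hr : IsRearSeqUpTo t phat rhat)
    (ploo : ℕ → ℕ → ℝ)
    (hploo : ∀ j k, ploo j k = ((x k : ℝ) - if k = j then 1 else 0) / ((n : ℝ) - 1))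
    (gloo rloo : ℕ → ℕ → ℝ)
    (hgloo : ∀ j, 0 < x j → IsProjDecr (ploo j) (gloo j))
    (hrloo : ∀ j, 0 < x j → IsRearSeqUpTo t (ploo j) (rloo j)) :
    ∀ j : ℕ,
      (if 0 < x j then ploo j j else 0) ≤ phat j ∧
      (if 0 < x j then rloo j j else 0) ≤ ((n : ℝ) / ((n : ℝ) - 1)) * rhat j ∧
      (if 0 < x j then gloo j j else 0) ≤ ((n : ℝ) / ((n : ℝ) - 1)) * ghat j := by
  have hn2 : (2 : ℝ) ≤ n := by exact_mod_cast hn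
  have hn1 : (0 : ℝ) < (n : ℝ) - 1 := by linarith
  have hn0 : (0 : ℝ) < n := by linarith
  have hc : (0 : ℝ) < (n : ℝ) / ((n : ℝ) - 1) := by positivity
  have hp0 : ∀ j, 0 ≤ phat j := fun j => by rw [hphat]; positivity
  have hcp : ∀ j, (n : ℝ) / ((n : ℝ) - 1) * phat j = x j / ((n : ℝ) - 1) := fun j => by
    rw [hphat]; field_simp
  have hle : ∀ j k, ploo j k ≤ (n : ℝ) / ((n : ℝ) - 1) * phat k := fun j k => by
    rw [hcp, hploo]
    apply div_le_div_of_nonneg_right _ hn1.le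
    split_ifs <;> linarith
  have hrs : IsRearSeqUpTo t (fun k => (n : ℝ) / ((n : ℝ) - 1) * phat k)
      (fun k => (n : ℝ) / ((n : ℝ) - 1) * rhat k) := by
    obtain ⟨r1, r2, σ, hσ⟩ := hr
    exact ⟨fun j k h1 h2 => mul_le_mul_of_nonneg_left (r1 j k h1 h2) hc.le,
      fun j h => by simp [r2 j h], σ, fun j => by simp only [hσ j]⟩
  have hr0 : ∀ j, 0 ≤ rhat j := by
    obtain ⟨r1, r2, σ, hσ⟩ := hr
    intro j
    rcases lt_or_ge t j with hj | hj
    · rw [r2 j hj]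
    · have := hσ ⟨j, by omega⟩
      simp only at this
      rw [this]
      exact hp0 _
  intro j
  split_ifs with hx
  · have hjt : j ≤ t := by
      by_contra h
      have := hsupp j (by omega)
      omega
    refine ⟨?_, aux_rear (hle j) (hrloo j hx) hrs j, ?_⟩
    · have hxn : x j ≤ n := by
        rw [← hsum]
        exact Finset.single_le_sum (f := x) (fun i _ => Nat.zero_le _)
          (Finset.mem_range.2 (by omega))
      have hxn' : (x j : ℝ) ≤ n := by exact_mod_cast hxn
      rw [hploo, hphat, if_pos rfl, div_le_div_iff₀ hn1 hn0]
      nlinarith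
    · refine aux_mono ?_ ?_ (hle j) (hgloo j hx) (aux_scale hc hg) j
      · refine summable_of_ne_finset_zero (s := Finset.range (t + 1)) (fun k hk => ?_)
        rw [Finset.mem_range] at hk
        rw [hploo, hsupp k (by omega), if_neg (by omega)]
        simp
      · refine summable_of_ne_finset_zero (s := Finset.range (t + 1)) (fun k hk => ?_)
        rw [Finset.mem_range] at hk
        rw [hcp, hsupp k (by omega)]
        simp
  · exact ⟨hp0 j, mul_nonneg hc.le (hr0 j), mul_nonneg hc.le (aux_nonneg hg.1 j)⟩
end

section
/- For every t ∈ ℕ and every x ∈ ℝ^{t+1}, the decreasing regression x* of x satisfies Σ_{j=0}^{t} x*_j = Σ_{j=0}^{t} x_j. -/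
/-- The decreasing cone in `ℝ^{t+1}`. -/
def decCone (t : ℕ) : Set (Fin (t + 1) → ℝ) :=
  {f | ∀ i j : Fin (t + 1), i ≤ j → f j ≤ f i}

/-- `xs` is the decreasing (isotonic) regression of `x`: it belongs to the decreasing
cone and minimizes the squared Euclidean distance to `x` over that cone. -/
def IsDecReg (t : ℕ) (x xs : Fin (t + 1) → ℝ) : Prop :=
  xs ∈ decCone t ∧ ∀ f ∈ decCone t, ∑ j, (x j - xs j) ^ 2 ≤ ∑ j, (x j - f j) ^ 2

/-- the decreasing regression preserves the total sum. -/
theorem stmt8 (t : ℕ) (x xs : Fin (t + 1) → ℝ) (h : IsDecReg t x xs) :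
    ∑ j, xs j = ∑ j, x j := by
  obtain ⟨h1, h2⟩ := h
  set S : ℝ := ∑ j, (x j - xs j) with hS
  have hn : (0 : ℝ) < (t : ℝ) + 1 := by positivity
  have key : ∀ c : ℝ, 2 * c * S ≤ ((t : ℝ) + 1) * c ^ 2 := by
    intro c
    have h3 := h2 (fun j => xs j + c) (fun i j hij => by
      have := h1 i j hij
      simpa using this)
    have h4 : ∑ j, (x j - (xs j + c)) ^ 2
        = ∑ j, (x j - xs j) ^ 2 - 2 * c * S + ((t : ℝ) + 1) * c ^ 2 := by
      have h5 : ∀ j, (x j - (xs j + c)) ^ 2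
          = (x j - xs j) ^ 2 - 2 * c * (x j - xs j) + c ^ 2 := fun j => by ring
      simp only [h5, Finset.sum_add_distrib, Finset.sum_sub_distrib (f := fun j => (x j - xs j) ^ 2),
        ← Finset.mul_sum, Finset.sum_const, Finset.card_univ, Fintype.card_fin, nsmul_eq_mul]
      push_cast
      rfl
    simp only [h4] at h3
    linarith
  have h6 := key (S / ((t : ℝ) + 1))
  have h7 : S ^ 2 / ((t : ℝ) + 1) ≤ 0 := by
    have e1 : 2 * (S / ((t : ℝ) + 1)) * S = 2 * (S ^ 2 / ((t : ℝ) + 1)) := by ring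
    have e2 : ((t : ℝ) + 1) * (S / ((t : ℝ) + 1)) ^ 2 = S ^ 2 / ((t : ℝ) + 1) := by
      field_simp
    rw [e1, e2] at h6
    linarith
  have h8 : S ^ 2 ≤ 0 := by
    by_contra hc
    push Not at hc
    exact absurd h7 (not_le.mpr (div_pos hc hn))
  have h9 : S = 0 := by nlinarith [sq_nonneg S, pow_eq_zero_iff (two_ne_zero) |>.mp (le_antisymm h8 (sq_nonneg S))]
  rw [hS, Finset.sum_sub_distrib] at h9
  linarith
end

section
/- Let t ∈ ℕ and x ∈ ℝ^{t+1}. Let m be the largest index in {0, …, t} maximizing the function m ↦ (Σ_{k=0}^{m} x_k)/(m+1), and set S = (Σ_{k=0}^{m} x_k)/(m+1). Then the decreasing regression x* of x satisfies x*_j = S for all 0 ≤ j ≤ m. -/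
theorem abel_nonpos : ∀ (n : ℕ) (a g : Fin n → ℝ), (∀ i j, i ≤ j → g j ≤ g i) → (∀ i, 0 ≤ g i) →
    (∀ m, ∑ k, (if k ≤ m then a k else 0) ≤ 0) → ∑ k, a k * g k ≤ 0 := by
  intro n
  induction n with
  | zero => intro a g _ _ _; simp
  | succ n ih =>
    intro a g hg h0 ha
    have h1 := ih (fun k => a k.castSucc) (fun k => g k.castSucc - g (Fin.last n))
      (fun i j hij => by
        have := hg i.castSucc j.castSucc (by simpa using hij)
        simpa using this)
      (fun i => by
        have := hg i.castSucc (Fin.last n) (Fin.le_last _)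
        simpa using this)
      (fun m => by
        have := ha m.castSucc
        rw [Fin.sum_univ_castSucc] at this
        have hn : ¬ (Fin.last n ≤ m.castSucc) := not_le.mpr (Fin.castSucc_lt_last m)
        simpa [hn] using this)
    have h2 := ha (Fin.last n)
    simp only [Fin.le_last, if_true] at h2
    have h3 : ∑ k, a k * g k = ∑ k : Fin n, a k.castSucc * (g k.castSucc - g (Fin.last n))
        + (∑ k, a k) * g (Fin.last n) := by
      rw [Fin.sum_univ_castSucc, Fin.sum_univ_castSucc (f := a), add_mul, Finset.sum_mul,
        ← add_assoc, ← Finset.sum_add_distrib]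
      congr 1
      exact Finset.sum_congr rfl fun k _ => by ring
    have h4 := mul_nonneg (neg_nonneg.mpr h2) (h0 (Fin.last n))
    rw [h3]
    linarith

/-- first step of the maximum upper sets algorithm. If `m` is the
largest index maximizing the initial averages `m ↦ (Σ_{k≤m} x_k)/(m+1)`, then the
decreasing regression is constant, equal to that maximal average, on `{0, …, m}`. -/
theorem stmt11 (t : ℕ) (x xs : Fin (t + 1) → ℝ) (h : IsDecReg t x xs)
    (m : Fin (t + 1))
    (hmax : ∀ m' : Fin (t + 1),
      (∑ k ∈ Finset.Iic m', x k) / ((m' : ℕ) + 1)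
        ≤ (∑ k ∈ Finset.Iic m, x k) / ((m : ℕ) + 1))
    (hlargest : ∀ m' : Fin (t + 1),
      (∑ k ∈ Finset.Iic m', x k) / ((m' : ℕ) + 1)
        = (∑ k ∈ Finset.Iic m, x k) / ((m : ℕ) + 1) → m' ≤ m) :
    ∀ j : Fin (t + 1), j ≤ m →
      xs j = (∑ k ∈ Finset.Iic m, x k) / ((m : ℕ) + 1) := by
  obtain ⟨hy, hmin⟩ := h
  have hdec : ∀ i j : Fin (t + 1), i ≤ j → xs j ≤ xs i := hy
  set S : ℝ := (∑ k ∈ Finset.Iic m, x k) / ((m : ℕ) + 1) with hS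
  have hpart : ∀ m' : Fin (t + 1), ∑ k, (if k ≤ m' then x k - S else 0)
      = ∑ k ∈ Finset.Iic m', x k - ((m' : ℕ) + 1) * S := by
    intro m'
    rw [← Finset.sum_filter]
    have : Finset.filter (fun k => k ≤ m') Finset.univ = Finset.Iic m' := by ext; simp
    rw [this, Finset.sum_sub_distrib]
    simp
  have hle : ∀ m' : Fin (t + 1), ∑ k, (if k ≤ m' then x k - S else 0) ≤ 0 := by
    intro m'
    rw [hpart]
    have := hmax m'
    rw [div_le_iff₀ (by positivity)] at this
    linarith
  have heq : ∑ k, (if k ≤ m then x k - S else 0) = 0 := by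
    rw [hpart, hS]
    have : ((m : ℕ) : ℝ) + 1 ≠ 0 := by positivity
    field_simp
    ring
  -- step A: `xs ≤ S`
  have hA : ∀ j, xs j ≤ S := by
    have h1 := abel_nonpos _ (fun k => x k - S) (fun k => max (xs k - S) 0)
      (fun i j hij => max_le_max (by linarith [hdec i j hij]) le_rfl)
      (fun i => le_max_right _ _) hle
    have h2 := hmin (fun k => min (xs k) S)
      (fun i j hij => min_le_min (hdec i j hij) le_rfl)
    have h3 : ∀ k, (x k - min (xs k) S) ^ 2 = (x k - xs k) ^ 2
        + 2 * ((x k - S) * max (xs k - S) 0) - (max (xs k - S) 0) ^ 2 := by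
      intro k
      rcases le_total (xs k) S with hk | hk
      · rw [min_eq_left hk, max_eq_right (by linarith)]; ring
      · rw [min_eq_right hk, max_eq_left (by linarith)]; ring
    simp only [h3, Finset.sum_sub_distrib, Finset.sum_add_distrib, ← Finset.mul_sum] at h2
    intro j
    have h4 := Finset.single_le_sum (f := fun k => (max (xs k - S) 0) ^ 2)
      (fun i _ => sq_nonneg _) (Finset.mem_univ j)
    have h5 : max (xs j - S) 0 = 0 := by
      apply pow_eq_zero_iff (two_ne_zero) |>.mp
      apply le_antisymm _ (sq_nonneg _)
      linarith
    linarith [le_max_left (xs j - S) 0]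
  -- step B
  have h1 := abel_nonpos _ (fun k => x k - S) (fun k => if k ≤ m then xs k - xs m else 0)
    (fun i j hij => by
      by_cases hj : j ≤ m
      · simp only [hj, hij.trans hj, if_true]; linarith [hdec i j hij]
      · by_cases hi : i ≤ m
        · simp only [hj, hi, if_true, if_false]; linarith [hdec i m hi]
        · simp [hj, hi])
    (fun i => by
      by_cases hi : i ≤ m
      · simp only [hi, if_true]; linarith [hdec i m hi]
      · simp [hi]) hle
  have h2 := hmin (fun k => if k ≤ m then S else xs k)
    (fun i j hij => by
      by_cases hj : j ≤ m
      · simp [hj, hij.trans hj]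
      · by_cases hi : i ≤ m
        · simp only [hj, hi, if_true, if_false]; exact hA j
        · simp only [hj, hi, if_false]; exact hdec i j hij)
  have h3 : ∀ k, (x k - if k ≤ m then S else xs k) ^ 2 = (x k - xs k) ^ 2
      + 2 * ((x k - S) * (if k ≤ m then xs k - xs m else 0))
      + 2 * (xs m - S) * (if k ≤ m then x k - S else 0)
      - (if k ≤ m then S - xs k else 0) ^ 2 := by
    intro k
    by_cases hk : k ≤ m
    · simp only [hk, if_true]; ring
    · simp only [hk, if_false]; ring
  simp only [h3, Finset.sum_sub_distrib, Finset.sum_add_distrib, ← Finset.mul_sum, heq] at h2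
  intro j hj
  have h4 := Finset.single_le_sum (f := fun k => (if k ≤ m then S - xs k else 0) ^ 2)
    (fun i _ => sq_nonneg _) (Finset.mem_univ j)
  have h5 : S - xs j = 0 := by
    apply pow_eq_zero_iff (two_ne_zero) |>.mp
    apply le_antisymm _ (sq_nonneg _)
    simp only [hj, if_true] at h4
    linarith
  linarith
end

section
/- Let t ∈ ℕ, let x ∈ ℝ^{t+1} have nonnegative coordinates, let q ∈ {0, …, t} satisfy x_q ≥ 1, and set y = x − e_q, where e_q ∈ ℝ^{t+1} has a 1 in coordinate q and 0 elsewhere. Then the decreasing regressions satisfy y*_q ≤ x*_q. -/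
/-- removing one unit from a coordinate `q` (with `x_q ≥ 1`) of a
nonnegative vector does not increase the value of the decreasing regression at `q`. -/
theorem stmt14 (t : ℕ) (x : Fin (t + 1) → ℝ) (hx : ∀ j, 0 ≤ x j)
    (q : Fin (t + 1)) (hq : 1 ≤ x q) (xs ys : Fin (t + 1) → ℝ)
    (h1 : IsDecReg t x xs)
    (h2 : IsDecReg t (fun j => x j - if j = q then 1 else 0) ys) :
    ys q ≤ xs q := by
  have a := h1.2 ys h2.1
  have b := h2.2 xs h1.1
  have key : ∑ j, ((x j - ys j) ^ 2 - (x j - xs j) ^ 2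
      + ((x j - if j = q then 1 else 0) - xs j) ^ 2
      - ((x j - if j = q then 1 else 0) - ys j) ^ 2) = 2 * (xs q - ys q) := by
    rw [Finset.sum_eq_single q]
    · simp only [if_true]
      ring
    · intro j _ hj
      simp only [if_neg hj]
      ring
    · intro h
      exact absurd (Finset.mem_univ q) h
  rw [Finset.sum_sub_distrib, Finset.sum_add_distrib, Finset.sum_sub_distrib] at key
  linarith
end

section
/- Let n ≥ 2, t ∈ ℕ, and let x ∈ ℕ^{t+1} be a frequency vector with Σ_{j=0}^{t} x_j = n. Define p̂ = x/n, regarded as a finitely supported element of ℓ² = ℓ²(ℕ; ℝ); let ĥ be either the ℓ²-projection ĝ of p̂ onto F^decr or the decreasing rearrangement r̂ of p̂. For each j with x_j > 0 set p̂^{(−j)} = (x − δ^{[j]})/(n−1), where δ^{[j]} has a 1 in coordinate j and 0 elsewhere, let ĥ^{(−j)} be the corresponding constrained estimator (projection onto F^decr or decreasing rearrangement) computed from p̂^{(−j)}, and define η̂_j = ĥ^{(−j)}_j and π̂_j = p̂^{(−j)}_j when x_j > 0 and η̂_j = π̂_j = 0 otherwise. Then b := Σ_{j=0}^{t} p̂_j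 (η̂_j − π̂_j) − Σ_{j=0}^{t} p̂_j (ĥ_j − p̂_j) satisfies b ≤ (Σ_{j=0}^{t} p̂_j ĥ_j)/(n−1) + (1 − Σ_{j=0}^{t} p̂_j²)/(n−1). -/
lemma aux_sub {u f : ℕ → ℝ} (hu : Summable (fun j => u j ^ 2))
    (hf : Summable (fun j => f j ^ 2)) : Summable (fun j => (u j - f j) ^ 2) := by
  refine Summable.of_nonneg_of_le (fun j => sq_nonneg _) (fun j => ?_)
    ((hu.mul_left 2).add (hf.mul_left 2))
  nlinarith [sq_nonneg (u j + f j)]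

lemma aux_strong {u g f : ℕ → ℝ} (hu : Summable (fun j => u j ^ 2))
    (hg : IsProjDecr u g) (hf : f ∈ FdecrSeq) :
    ∑' j, (u j - g j) ^ 2 + (1 / 2) * ∑' j, (g j - f j) ^ 2 ≤ ∑' j, (u j - f j) ^ 2 := by
  obtain ⟨hgF, hmin⟩ := hg
  have s1 := aux_sub hu hgF.1
  have s2 := aux_sub hu hf.1
  have s3 := aux_sub hgF.1 hf.1
  have hm : (fun j => (1 / 2) * g j + (1 / 2) * f j) ∈ FdecrSeq := by
    refine ⟨?_, fun j => ?_⟩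
    · refine Summable.of_nonneg_of_le (fun j => sq_nonneg _) (fun j => ?_) (hgF.1.add hf.1)
      nlinarith [sq_nonneg (g j - f j), sq_nonneg (g j), sq_nonneg (f j)]
    · have := hgF.2 j
      have := hf.2 j
      simp only
      linarith
  have h := hmin _ hm
  have e : ∑' j, (u j - ((1 / 2) * g j + (1 / 2) * f j)) ^ 2
      = (1 / 2) * ∑' j, (u j - g j) ^ 2 + (1 / 2) * ∑' j, (u j - f j) ^ 2
        - (1 / 4) * ∑' j, (g j - f j) ^ 2 := by
    rw [← tsum_mul_left, ← tsum_mul_left, ← tsum_mul_left,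
      ← (s1.mul_left (1 / 2)).tsum_add (s2.mul_left (1 / 2)),
      ← ((s1.mul_left (1 / 2)).add (s2.mul_left (1 / 2))).tsum_sub (s3.mul_left (1 / 4))]
    refine tsum_congr fun j => ?_
    ring
  rw [e] at h
  linarith

lemma aux_mono_s16 {u v g g' : ℕ → ℝ} (hu : Summable (fun j => u j ^ 2))
    (hv : Summable (fun j => v j ^ 2)) (huv : ∀ j, v j ≤ u j)
    (hg : IsProjDecr u g) (hg' : IsProjDecr v g') (j : ℕ) : g' j ≤ g j := by
  have hmin : (fun j => min (g j) (g' j)) ∈ FdecrSeq := by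
    refine ⟨?_, fun j => min_le_min (hg.1.2 j) (hg'.1.2 j)⟩
    refine Summable.of_nonneg_of_le (fun j => sq_nonneg _) (fun j => ?_) (hg.1.1.add hg'.1.1)
    rcases min_choice (g j) (g' j) with h | h <;> simp only [h] <;>
      nlinarith [sq_nonneg (g j), sq_nonneg (g' j)]
  have hmax : (fun j => max (g j) (g' j)) ∈ FdecrSeq := by
    refine ⟨?_, fun j => max_le_max (hg.1.2 j) (hg'.1.2 j)⟩
    refine Summable.of_nonneg_of_le (fun j => sq_nonneg _) (fun j => ?_) (hg.1.1.add hg'.1.1)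
    rcases max_choice (g j) (g' j) with h | h <;> simp only [h] <;>
      nlinarith [sq_nonneg (g j), sq_nonneg (g' j)]
  have h1 := aux_strong hv hg' hmin
  have h2 := hg.2 _ hmax
  have s1 := aux_sub hv hmin.1
  have s2 := aux_sub hu hmax.1
  have s3 := aux_sub hv hg'.1.1
  have s4 := aux_sub hu hg.1.1
  have h3 : ∑' j, (v j - min (g j) (g' j)) ^ 2 + ∑' j, (u j - max (g j) (g' j)) ^ 2
      ≤ ∑' j, (v j - g' j) ^ 2 + ∑' j, (u j - g j) ^ 2 := by
    rw [← s1.tsum_add s2, ← s3.tsum_add s4]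
    refine (s1.add s2).tsum_le_tsum (fun j => ?_) (s3.add s4)
    rcases le_total (g j) (g' j) with h | h
    · simp only [min_eq_left h, max_eq_right h]
      nlinarith [mul_nonneg (sub_nonneg.2 h) (sub_nonneg.2 (huv j))]
    · simp only [min_eq_right h, max_eq_left h]
      exact le_refl _
  have s5 := aux_sub hg'.1.1 hmin.1
  have h4 : (g' j - min (g j) (g' j)) ^ 2 ≤ ∑' j, (g' j - min (g j) (g' j)) ^ 2 :=
    s5.le_tsum j (fun i _ => sq_nonneg _)
  have h5 : (g' j - min (g j) (g' j)) ^ 2 = 0 := by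
    refine le_antisymm ?_ (sq_nonneg _)
    linarith
  have h6 : g' j - min (g j) (g' j) = 0 := by simpa using h5
  have := min_le_left (g j) (g' j)
  linarith

lemma aux_rear_s16 {t : ℕ} {u v r r' : ℕ → ℝ} (huv : ∀ j, v j ≤ u j)
    (hr : IsRearSeqUpTo t u r) (hr' : IsRearSeqUpTo t v r') (j : ℕ) (hj : j ≤ t) :
    r' j ≤ r j := by
  obtain ⟨hd, -, σ, hσ⟩ := hr
  obtain ⟨hd', -, τ, hτ⟩ := hr'
  obtain ⟨k, hk, hk'⟩ : ∃ k : Fin (t + 1), (k : ℕ) ≤ j ∧ j ≤ (σ.symm (τ k) : ℕ) := by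
    by_contra! hcon
    let J : Fin (t + 1) := ⟨j, by omega⟩
    have hsub : (Finset.Iic J).map (τ.trans σ.symm).toEmbedding ⊆ Finset.Iio J := by
      intro a ha
      simp only [Finset.mem_map, Finset.mem_Iic, Equiv.coe_toEmbedding, Equiv.trans_apply] at ha
      obtain ⟨k, hk, rfl⟩ := ha
      exact Finset.mem_Iio.2 (Fin.lt_def.2 (hcon k (Fin.le_def.1 hk)))
    have := Finset.card_le_card hsub
    rw [Finset.card_map, Fin.card_Iic, Fin.card_Iio] at this
    omega
  have h1 := hd' k j hk hj
  have h2 := hd j _ hk' (by have := (σ.symm (τ k)).2; omega)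
  rw [hσ, Equiv.apply_symm_apply] at h2
  rw [hτ] at h1
  exact h1.trans ((huv _).trans h2)

lemma aux_rear_scale {t : ℕ} {v r : ℕ → ℝ} {c : ℝ} (hc : 0 < c) (hr : IsRearSeqUpTo t v r) :
    IsRearSeqUpTo t (fun j => c * v j) (fun j => c * r j) := by
  obtain ⟨h1, h2, σ, h3⟩ := hr
  refine ⟨fun j k a b => mul_le_mul_of_nonneg_left (h1 j k a b) hc.le, fun j hj => ?_, σ,
    fun j => ?_⟩
  · simp [h2 j hj]
  · simp [h3 j]

/-- upper bound for the cross-validation quantity `b`. With `p̂ = x/n`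
the empirical estimator of a frequency vector with total count `n ≥ 2` supported on
`{0, …, t}`, `ĥ` the constrained estimator (either the ℓ²-projection of `p̂` onto
`F^decr` or the decreasing rearrangement of `p̂`), and `η̂_j, π̂_j` the diagonal
values of the corresponding leave-one-out estimators (set to `0` when `x_j = 0`),
one has `b ≤ (Σ_j p̂_j ĥ_j)/(n−1) + (1 − Σ_j p̂_j²)/(n−1)`. -/
theorem stmt16 (n t : ℕ) (hn : 2 ≤ n) (x : ℕ → ℕ)
    (hsupp : ∀ j, t < j → x j = 0)
    (hsum : ∑ j ∈ Finset.range (t + 1), x j = n)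
    (phat : ℕ → ℝ) (hphat : ∀ j, phat j = (x j : ℝ) / n)
    (ploo : ℕ → ℕ → ℝ)
    (hploo : ∀ j k, ploo j k = ((x k : ℝ) - if k = j then 1 else 0) / ((n : ℝ) - 1))
    (hhat : ℕ → ℝ) (hloo : ℕ → ℕ → ℝ)
    (hcase :
      (IsProjDecr phat hhat ∧ ∀ j, 0 < x j → IsProjDecr (ploo j) (hloo j)) ∨
      (IsRearSeqUpTo t phat hhat ∧ ∀ j, 0 < x j → IsRearSeqUpTo t (ploo j) (hloo j)))
    (b : ℝ)
    (hb : b = (∑ j ∈ Finset.range (t + 1),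
          phat j * ((if 0 < x j then hloo j j else 0) - (if 0 < x j then ploo j j else 0)))
        - ∑ j ∈ Finset.range (t + 1), phat j * (hhat j - phat j)) :
    b ≤ (∑ j ∈ Finset.range (t + 1), phat j * hhat j) / ((n : ℝ) - 1)
      + (1 - ∑ j ∈ Finset.range (t + 1), phat j ^ 2) / ((n : ℝ) - 1) := by
  have hn1 : (0 : ℝ) < (n : ℝ) - 1 := by
    have : (2 : ℝ) ≤ n := by exact_mod_cast hn
    linarith
  have hn0 : (0 : ℝ) < n := by linarith
  have hc : (0 : ℝ) < n / ((n : ℝ) - 1) := div_pos hn0 hn1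
  have hle : ∀ j k, ploo j k ≤ n / ((n : ℝ) - 1) * phat k := by
    intro j k
    have e : n / ((n : ℝ) - 1) * phat k = (x k : ℝ) / ((n : ℝ) - 1) := by
      rw [hphat]
      field_simp
    rw [e, hploo]
    refine div_le_div_of_nonneg_right ?_ hn1.le
    split_ifs <;> linarith
  have key : ∀ j, j ≤ t → 0 < x j → hloo j j ≤ n / ((n : ℝ) - 1) * hhat j := by
    intro j hj hx
    rcases hcase with ⟨h1, h2⟩ | ⟨h1, h2⟩
    · refine aux_mono_s16 (u := fun k => n / ((n : ℝ) - 1) * phat k) (v := ploo j) ?_ ?_ (hle j)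
        (aux_scale hc h1) (h2 j hx) j
      · refine summable_of_ne_finset_zero (s := Finset.range (t + 1)) fun k hk => ?_
        have hk' : t < k := by simpa using hk
        simp [hphat, hsupp k hk']
      · refine summable_of_ne_finset_zero (s := Finset.range (t + 1)) fun k hk => ?_
        have hk' : t < k := by simpa using hk
        have : k ≠ j := by omega
        simp [hploo, hsupp k hk', this]
    · exact aux_rear_s16 (hle j) (aux_rear_scale hc h1) (h2 j hx) j hj
  have hS : ∑ j ∈ Finset.range (t + 1), phat j = 1 := by
    simp only [hphat]
    rw [← Finset.sum_div, ← Nat.cast_sum, hsum, div_self hn0.ne']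
  have hterm : ∀ j ∈ Finset.range (t + 1),
      phat j * ((if 0 < x j then hloo j j else 0) - (if 0 < x j then ploo j j else 0))
        - phat j * (hhat j - phat j)
      ≤ phat j * hhat j / ((n : ℝ) - 1) + (phat j - phat j ^ 2) / ((n : ℝ) - 1) := by
    intro j hj
    have hj' : j ≤ t := by simpa [Nat.lt_succ_iff] using hj
    by_cases hx : 0 < x j
    · have hk := key j hj' hx
      have hp : 0 ≤ phat j := by rw [hphat]; positivity
      have h1 := mul_le_mul_of_nonneg_left hk hp
      have e : ploo j j = (n * phat j - 1) / ((n : ℝ) - 1) := by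
        rw [hploo, hphat, if_pos rfl]
        field_simp
      rw [if_pos hx, if_pos hx, e]
      have e2 : phat j * hhat j / ((n : ℝ) - 1) + (phat j - phat j ^ 2) / ((n : ℝ) - 1)
        = phat j * (n / ((n : ℝ) - 1) * hhat j) - phat j * ((n * phat j - 1) / ((n : ℝ) - 1))
          - phat j * (hhat j - phat j) := by
        field_simp
        ring
      rw [e2]
      linarith
    · have : phat j = 0 := by
        rw [hphat, Nat.eq_zero_of_not_pos hx]
        simp
      simp [this]
  have h := Finset.sum_le_sum hterm
  rw [Finset.sum_sub_distrib, Finset.sum_add_distrib, ← Finset.sum_div, ← Finset.sum_div,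
    Finset.sum_sub_distrib, hS] at h
  rw [hb]
  exact h
end

section
/- Let p ∈ F^decr (in particular this holds when the true probability mass function is decreasing), let w ∈ ℓ²(ℕ; ℝ), and let g be the ℓ²-projection of w onto F^decr. Then for every β ∈ [0, 1], ‖β g + (1−β) w − p‖₂ ≤ ‖w − p‖₂. In particular, when p is a decreasing probability mass function, the stacked Grenander estimator φ = β ĝ + (1−β) p̂ built from the empirical estimator p̂ and its Grenander estimator ĝ (the ℓ²-projection of p̂ onto F^decr) satisfies ‖φ − p‖₂ ≤ ‖p̂ − p‖₂ for every β ∈ [0, 1]. -/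
/-- The decreasing cone `F^decr` in `ℓ²(ℕ; ℝ)`. -/
def Fdecr : Set (lp (fun _ : ℕ => ℝ) 2) :=
  {f | ∀ j : ℕ, (f : ℕ → ℝ) (j + 1) ≤ (f : ℕ → ℝ) j}

/-- if `p ∈ F^decr`, `w ∈ ℓ²` and `g` is the ℓ²-projection of `w` onto
`F^decr`, then every convex combination `β g + (1−β) w` with `β ∈ [0,1]` is at least
as close to `p` as `w` is. -/
theorem stmt19 (p w g : lp (fun _ : ℕ => ℝ) 2) (hp : p ∈ Fdecr)
    (hgmem : g ∈ Fdecr) (hgproj : ∀ f ∈ Fdecr, ‖w - g‖ ≤ ‖w - f‖)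
    (β : ℝ) (hβ : β ∈ Set.Icc (0 : ℝ) 1) :
    ‖β • g + (1 - β) • w - p‖ ≤ ‖w - p‖ := by
  have hconv : Convex ℝ Fdecr := by
    intro x hx y hy a b ha hb _ j
    have h1 := mul_le_mul_of_nonneg_left (hx j) ha
    have h2 := mul_le_mul_of_nonneg_left (hy j) hb
    exact add_le_add h1 h2
  have hinf : ‖w - g‖ = ⨅ f : Fdecr, ‖w - f‖ := by
    haveI : Nonempty Fdecr := ⟨⟨g, hgmem⟩⟩
    apply le_antisymm
    · exact le_ciInf fun f => hgproj f.1 f.2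
    · exact ciInf_le (f := fun f : Fdecr => ‖w - f‖)
        ⟨0, by rintro _ ⟨f, rfl⟩; exact norm_nonneg _⟩ ⟨g, hgmem⟩
  have hin := (norm_eq_iInf_iff_real_inner_le_zero hconv hgmem).1 hinf p hp
  have hgp : ‖g - p‖ ≤ ‖w - p‖ := by
    have e : w - p = (w - g) - (p - g) := by abel
    have h := norm_sub_sq_real (w - g) (p - g)
    rw [← e, norm_sub_rev p g] at h
    refine (sq_le_sq₀ (norm_nonneg _) (norm_nonneg _)).1 ?_
    nlinarith [sq_nonneg ‖w - g‖]
  obtain ⟨h0, h1⟩ := hβ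
  have e : β • g + (1 - β) • w - p = β • (g - p) + (1 - β) • (w - p) := by module
  rw [e]
  calc _ ≤ ‖β • (g - p)‖ + ‖(1 - β) • (w - p)‖ := norm_add_le _ _
    _ = β * ‖g - p‖ + (1 - β) * ‖w - p‖ := by
      rw [norm_smul, norm_smul, Real.norm_of_nonneg h0, Real.norm_of_nonneg (sub_nonneg.2 h1)]
    _ ≤ ‖w - p‖ := by nlinarith
end
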